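/- arXiv:2011.10099 — 2 statements merged into one kernel-verified Lean document; each statement's English description precedes it below -/
import Mathlib

section
/- (Nondegeneracy of the intersection form on the non-unipotent part, Section 2.3) Take K = ℂ. If x ∈ V_{≠1} satisfies I(x,y) = 0 for all y ∈ V_{≠1}, then x = 0; that is, the restriction of I to V_{≠1} is nondegenerate. -/
/-- Let `W` be an `M`-invariant subspace on which `M - 1` is surjective. Then `W` is left orthogonal
to the generalized `1`-eigenspace of `M` for every `M`-invariant bilinear form. -/
theorem bilinear_eq_zero_of_mem_genEigenspace_one {K V : Type*} [Field K] [AddCommGroup V]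
    [Module K V] (B : V →ₗ[K] V →ₗ[K] K) (M : Module.End K V)
    (hB : ∀ x y, B (M x) (M y) = B x y) (W : Submodule K V) (hM : ∀ x ∈ W, M x ∈ W)
    (hsurj : ∀ x ∈ W, ∃ z ∈ W, M z - z = x) (k : ℕ) :
    ∀ y, ((M - 1) ^ k) y = 0 → ∀ x ∈ W, B x y = 0 := by
  induction k with
  | zero => intro y hy x _; simp_all
  | succ k ih =>
    intro y hy x hx
    obtain ⟨z, hz, rfl⟩ := hsurj x hx
    have h := ih (M y - y) (by simpa [pow_succ] using hy) (M z) (hM z hz)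
    simp only [map_sub, LinearMap.sub_apply, hB] at h ⊢
    linear_combination -h

/-- Nondegeneracy of the intersection form on the non-unipotent part
`V_{≠1} = ⨆_{λ ≠ 1} E_λ` (Section 2.3). -/
theorem intersection_form_nondegenerate_on_non_unipotent_part
    {V : Type*} [AddCommGroup V] [Module ℂ V] [FiniteDimensional ℂ V]
    (n : ℕ) (M : V ≃ₗ[ℂ] V) (Var : Module.Dual ℂ V ≃ₗ[ℂ] V)
    (L : V → V → ℂ) (hL : ∀ x y, L x y = Var.symm x y)
    (hsym : ∀ x y, L (M x) y = (-1 : ℂ) ^ (n + 1) * L y x)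
    (I : V → V → ℂ) (hI : ∀ x y, I x y = Var.symm (M x - x) y)
    (Vne1 : Submodule ℂ V)
    (hVne1 : Vne1 = ⨆ (μ : ℂ) (_ : μ ≠ 1),
      Module.End.maxGenEigenspace (M : V →ₗ[ℂ] V) μ) :
    ∀ x ∈ Vne1, (∀ y ∈ Vne1, I x y = 0) → x = 0 := by
  subst hVne1
  set f : Module.End ℂ V := (M : V →ₗ[ℂ] V) with hf
  set W : Submodule ℂ V := ⨆ (μ : ℂ) (_ : μ ≠ 1), f.maxGenEigenspace μ with hW
  have hM : ∀ x ∈ W, f x ∈ W := by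
    suffices W ≤ W.comap f from this
    refine iSup₂_le fun μ hμ x hx => ?_
    exact (le_iSup₂ (f := fun (μ : ℂ) (_ : μ ≠ 1) => f.maxGenEigenspace μ) μ hμ)
      (Module.End.mapsTo_maxGenEigenspace_of_comm (Commute.refl f) μ hx)
  have hN : ∀ x ∈ W, (f - 1) x ∈ W := fun x hx => W.sub_mem (hM x hx) hx
  have hdisj : Disjoint (f.maxGenEigenspace 1) W := f.independent_maxGenEigenspace 1
  have htop : f.maxGenEigenspace 1 ⊔ W = ⊤ := by
    rw [eq_top_iff, ← Module.End.iSup_maxGenEigenspace_eq_top f]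
    refine iSup_le fun μ => ?_
    by_cases hμ : μ = 1
    · exact hμ ▸ le_sup_left
    · exact le_sup_of_le_right
        (le_iSup₂ (f := fun (μ : ℂ) (_ : μ ≠ 1) => f.maxGenEigenspace μ) μ hμ)
  have hker : ∀ x ∈ W, (f - 1) x = 0 → x = 0 := fun x hx h =>
    (Submodule.disjoint_def.mp hdisj) x
      ((Module.End.mem_maxGenEigenspace f 1 x).mpr ⟨1, by simpa using h⟩) hx
  have hsurj : ∀ x ∈ W, ∃ z ∈ W, f z - z = x := by
    have hinj : Function.Injective ((f - 1).restrict hN) := by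
      rw [injective_iff_map_eq_zero]
      exact fun x h => Subtype.ext (hker x x.2 (congrArg Subtype.val h))
    intro x hx
    obtain ⟨z, hz⟩ := LinearMap.injective_iff_surjective.mp hinj ⟨x, hx⟩
    exact ⟨z, z.2, congrArg Subtype.val hz⟩
  have hB : ∀ x y, Var.symm (f x) (f y) = Var.symm x y := by
    intro x y
    have h₁ := hsym x (M y)
    have h₂ := hsym y x
    rw [h₂, ← mul_assoc, ← mul_pow] at h₁
    simpa [hL, hf] using h₁
  intro x hx hxI
  refine hker x hx (Var.symm.injective ?_)
  rw [map_zero]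
  ext y
  obtain ⟨a, ha, b, hb, rfl⟩ := Submodule.mem_sup.mp (htop ▸ Submodule.mem_top : y ∈ _ ⊔ W)
  obtain ⟨k, hk⟩ := (Module.End.mem_maxGenEigenspace f 1 a).mp ha
  have h₁ : Var.symm ((f - 1) x) a = 0 :=
    bilinear_eq_zero_of_mem_genEigenspace_one Var.symm.toLinearMap f hB W hM hsurj k a
      (by simpa using hk) _ (hN x hx)
  have h₂ : Var.symm ((f - 1) x) b = 0 := (hI x b).symm.trans (hxI b hb)
  rw [map_add, h₁, h₂, add_zero, LinearMap.zero_apply]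
end

section
/- (Radical of the intersection form on the unipotent part, Section 2.8) Take K = ℂ. The radical of the restriction of I to V_1 equals ker(M − id); that is, {x ∈ V_1 | I(x,y) = 0 for all y ∈ V_1} = ker(M − id). -/
/-- If `B` is an `M`-invariant bilinear form and `z` is killed by `(M - 1) ^ k`, then `z` is left
orthogonal to the range of `(M - 1) ^ k`. -/
theorem bilin_sub_one_pow_apply_eq_zero {K V : Type*} [Field K] [AddCommGroup V] [Module K V]
    (M : V ≃ₗ[K] V) (B : V →ₗ[K] Module.Dual K V) (hB : ∀ x y, B (M x) (M y) = B x y)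
    (k : ℕ) (z w : V) (hz : (((M : V →ₗ[K] V) - 1 : Module.End K V) ^ k) z = 0) :
    B z ((((M : V →ₗ[K] V) - 1 : Module.End K V) ^ k) w) = 0 := by
  induction k generalizing z with
  | zero =>
    have hz' : z = 0 := by simpa using hz
    simp [hz']
  | succ k ih =>
    set N : Module.End K V := (M : V →ₗ[K] V) - 1 with hN
    have hNv (v : V) : N v = M v - v := by simp [hN]
    obtain ⟨u, rfl⟩ := M.surjective z
    have hcomm : Commute (N ^ (k + 1)) (M : Module.End K V) :=
      (Commute.sub_left (Commute.refl _) (Commute.one_left _)).pow_left _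
    have hu : (N ^ (k + 1)) u = 0 := by
      apply M.injective
      rw [map_zero, ← hz]
      exact (LinearMap.congr_fun hcomm.eq u).symm
    have key := ih (N u) (by rwa [pow_succ, Module.End.mul_apply] at hu)
    rw [hNv u, map_sub, LinearMap.sub_apply] at key
    rw [pow_succ', Module.End.mul_apply, hNv, map_sub, hB]
    linear_combination -key


/-- The radical of the restriction of `I` to the unipotent part
`V_1 = E_1` equals `ker (M - id)` (Section 2.8). -/
theorem radical_intersection_form_on_unipotent_part
    {V : Type*} [AddCommGroup V] [Module ℂ V] [FiniteDimensional ℂ V]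
    (n : ℕ) (M : V ≃ₗ[ℂ] V) (Var : Module.Dual ℂ V ≃ₗ[ℂ] V)
    (L : V → V → ℂ) (hL : ∀ x y, L x y = Var.symm x y)
    (hsym : ∀ x y, L (M x) y = (-1 : ℂ) ^ (n + 1) * L y x)
    (I : V → V → ℂ) (hI : ∀ x y, I x y = Var.symm (M x - x) y)
    (V1 : Submodule ℂ V)
    (hV1 : V1 = Module.End.maxGenEigenspace (M : V →ₗ[ℂ] V) 1) :
    {x : V | x ∈ V1 ∧ ∀ y ∈ V1, I x y = 0} =
      ↑(LinearMap.ker ((M : V →ₗ[ℂ] V) - LinearMap.id)) := by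
  have hinv (x y : V) : Var.symm (M x) (M y) = Var.symm x y := by
    have hsq : ((-1 : ℂ) ^ (n + 1)) * (-1) ^ (n + 1) = 1 := by
      rw [← mul_pow]; simp
    rw [← hL, ← hL, hsym, hsym, ← mul_assoc, hsq, one_mul]
  subst hV1
  ext x
  simp only [Set.mem_ofPred_eq, SetLike.mem_coe, LinearMap.mem_ker, LinearMap.sub_apply,
    LinearMap.id_apply, LinearEquiv.coe_coe]
  set N : Module.End ℂ V := (M : V →ₗ[ℂ] V) - 1 with hN
  have hNv (v : V) : N v = M v - v := by simp [hN]
  have hmem (v : V) :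
      v ∈ Module.End.maxGenEigenspace (M : V →ₗ[ℂ] V) 1 ↔ ∃ k : ℕ, (N ^ k) v = 0 := by
    rw [Module.End.mem_maxGenEigenspace, one_smul]
  constructor
  · rintro ⟨hx, hI0⟩
    obtain ⟨m, hm⟩ := (hmem x).1 hx
    obtain ⟨k, hk, hmk⟩ :=
      ((LinearMap.eventually_isCompl_ker_pow_range_pow N).and
        (Filter.eventually_ge_atTop m)).exists
    have hz : (N ^ k) (N x) = 0 := by
      rw [← Module.End.mul_apply, ← pow_succ]
      exact Module.End.pow_map_zero_of_le (hmk.trans k.le_succ) hm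
    rw [← hNv, ← map_eq_zero_iff Var.symm Var.symm.injective]
    ext y
    obtain ⟨a, ha, b, ⟨w, rfl⟩, rfl⟩ :=
      Submodule.mem_sup.1 (hk.sup_eq_top.ge (Submodule.mem_top (x := y)))
    have h1 := hI0 a ((hmem a).2 ⟨k, ha⟩)
    rw [hI, ← hNv] at h1
    have h2 := bilin_sub_one_pow_apply_eq_zero M (Var.symm : V →ₗ[ℂ] Module.Dual ℂ V) hinv k
      (N x) w hz
    rw [map_add, h1, zero_add]
    exact h2
  · intro hx
    refine ⟨(hmem x).2 ⟨1, by rw [pow_one, hNv, hx]⟩, fun y _ => ?_⟩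
    rw [hI, hx, map_zero, LinearMap.zero_apply]
end
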